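/- Let Ω be a uniform domain with Whitney covering W, 0 < σ < 1 and 1 ≤ p < q < ∞ with σ > d/p − d/q, and f ∈ L¹_loc(Ω). Then Σ_{Q∈W} ( Σ_{L∈W} ∫_L |f(y)−f_L|^q / D(Q,L)^{σq+d} dy )^{p/q} ℓ(Q)^d ≤ C ∫_Ω ( ∫_Ω |f(x)−f(y)|^q / |x−y|^{σq+d} dy )^{p/q} dx. -/

import Mathlib

open MeasureTheory ENNReal

/-- An axis-parallel cube in `ℝ^d`, identified with the closed ball of radius `side/2`
around its center in the sup metric on `Fin d → ℝ`. -/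
structure Cube (d : ℕ) where
  center : Fin d → ℝ
  side : ℝ
  side_pos : 0 < side

/-- The set of points of a cube. -/
def Cube.toSet {d : ℕ} (Q : Cube d) : Set (Fin d → ℝ) :=
  Metric.closedBall Q.center (Q.side / 2)

/-- Distance between two sets. -/
noncomputable def setDist {d : ℕ} (A B : Set (Fin d → ℝ)) : ℝ :=
  sInf (Set.image2 dist A B)

/-- The long distance `D(Q,S) = ℓ(Q) + ℓ(S) + dist(Q,S)` between two cubes. -/
noncomputable def longDist {d : ℕ} (Q S : Cube d) : ℝ :=
  Q.side + S.side + setDist Q.toSet S.toSet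

/-- A Whitney covering of `Ω`: a family of essentially disjoint (dyadic-type) cubes whose
union is `Ω`, with side-lengths comparable to the distance to `∂Ω`, and finite
superposition of the dilated cubes `50Q`. -/
structure WhitneyCovering (d : ℕ) (Ω : Set (Fin d → ℝ)) where
  cubes : Set (Cube d)
  covers : (⋃ Q ∈ cubes, Q.toSet) = Ω
  essDisjoint : ∀ Q ∈ cubes, ∀ S ∈ cubes, Q ≠ S →
    interior Q.toSet ∩ interior S.toSet = ∅
  CW : ℝ
  one_le_CW : 1 ≤ CW
  dist_lb : ∀ Q ∈ cubes, CW * Q.side ≤ setDist Q.toSet (frontier Ω)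
  dist_ub : ∀ Q ∈ cubes, setDist Q.toSet (frontier Ω) ≤ 4 * CW * Q.side
  finiteOverlap : ∃ N : ℕ, ∀ x : Fin d → ℝ,
    {Q ∈ cubes | x ∈ Metric.closedBall Q.center (25 * Q.side)}.Finite ∧
    {Q ∈ cubes | x ∈ Metric.closedBall Q.center (25 * Q.side)}.ncard ≤ N

/-- `S ∈ SH_ρ(P)` : the cube `S` of the covering lies in the `ρ`-shadow of `P`, i.e.
`S ⊆ B(x_P, ρ ℓ(P))`. -/
def memShadow {d : ℕ} {Ω : Set (Fin d → ℝ)} (W : WhitneyCovering d Ω) (ρ : ℝ)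
    (S P : Cube d) : Prop :=
  S ∈ W.cubes ∧ P ∈ W.cubes ∧ S.toSet ⊆ Metric.closedBall P.center (ρ * P.side)

/-- An `ε`-admissible chain of Whitney cubes joining `Q` to `S`. -/
structure AdmissibleChain {d : ℕ} {Ω : Set (Fin d → ℝ)} (W : WhitneyCovering d Ω)
    (ε : ℝ) (Q S : Cube d) where
  M : ℕ
  M_pos : 0 < M
  c : Fin M → Cube d
  mem : ∀ j, c j ∈ W.cubes
  first : c ⟨0, M_pos⟩ = Q
  last : c ⟨M - 1, Nat.sub_lt M_pos Nat.one_pos⟩ = S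
  neighbors : ∀ (j : ℕ) (h : j + 1 < M),
    ((c ⟨j, Nat.lt_of_succ_lt h⟩).toSet ∩ (c ⟨j + 1, h⟩).toSet).Nonempty
  length_le : ∑ j, (c j).side ≤ ε⁻¹ * longDist Q S
  j₀ : Fin M
  growth₁ : ∀ j : Fin M, j ≤ j₀ → ε * longDist Q (c j) ≤ (c j).side
  growth₂ : ∀ j : Fin M, j₀ ≤ j → ε * longDist (c j) S ≤ (c j).side

/-- `Ω` (with Whitney covering `W`) is an `ε`-uniform domain: any two Whitney cubes are
joined by an `ε`-admissible chain. -/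
def IsUniformDomain {d : ℕ} {Ω : Set (Fin d → ℝ)} (W : WhitneyCovering d Ω) (ε : ℝ) : Prop :=
  ∀ Q ∈ W.cubes, ∀ S ∈ W.cubes, Nonempty (AdmissibleChain W ε Q S)

/-- The non-centered Hardy–Littlewood maximal function, taken over cubes
(closed balls in the sup metric on `Fin d → ℝ`) containing `x`. -/
noncomputable def maximal (d : ℕ) (g : (Fin d → ℝ) → ℝ≥0∞) (x : Fin d → ℝ) : ℝ≥0∞ :=
  ⨆ (c : Fin d → ℝ) (r : ℝ) (_ : 0 < r) (_ : x ∈ Metric.closedBall c r),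
    (∫⁻ y in Metric.closedBall c r, g y) / volume (Metric.closedBall c r)

lemma tsum_rpow_le_tsum_rpow {ι : Type*} (u : ι → ℝ≥0∞) {t : ℝ} (ht0 : 0 < t) (ht1 : t ≤ 1) :
    (∑' i, u i) ^ t ≤ ∑' i, u i ^ t := by
  classical
  have hfin : ∀ s : Finset ι, (∑ i ∈ s, u i) ^ t ≤ ∑ i ∈ s, u i ^ t := by
    intro s
    induction s using Finset.induction_on with
    | empty => simp [ht0]
    | insert a s ha ih =>
      rw [Finset.sum_insert ha, Finset.sum_insert ha]
      exact (ENNReal.rpow_add_le_add_rpow _ _ ht0.le ht1).trans (by gcongr)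
  rw [← ENNReal.le_rpow_inv_iff ht0, ENNReal.tsum_eq_iSup_sum]
  exact iSup_le fun s =>
    (ENNReal.le_rpow_inv_iff ht0).2 ((hfin s).trans (ENNReal.sum_le_tsum s))

/-- On a probability space, the `q`-th moment of `f - ∫ f` is controlled by that of `f - c` for
any constant `c`. -/
lemma lintegral_sub_integral_rpow_le {α : Type*} [MeasurableSpace α] (ν : Measure α)
    [IsProbabilityMeasure ν] {f : α → ℝ} (hf : Integrable f ν) {q : ℝ} (hq : 1 ≤ q) (c : ℝ) :
    ∫⁻ y, ‖f y - ∫ z, f z ∂ν‖ₑ ^ q ∂ν ≤ 2 ^ q * ∫⁻ y, ‖c - f y‖ₑ ^ q ∂ν := by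
  have hq0 : 0 < q := by linarith
  set m := ∫ z, f z ∂ν
  have hcf : AEStronglyMeasurable (fun y => c - f y) ν :=
    aestronglyMeasurable_const.sub hf.aestronglyMeasurable
  have hm : ‖c - m‖ₑ ^ q ≤ ∫⁻ y, ‖c - f y‖ₑ ^ q ∂ν := by
    have h1 : c - m = ∫ y, (c - f y) ∂ν := by
      rw [integral_sub (integrable_const c) hf]; simp [m]
    have h2 : ‖c - m‖ₑ ≤ eLpNorm' (fun y => c - f y) 1 ν := by
      rw [h1]
      refine (enorm_integral_le_lintegral_enorm _).trans ?_
      simp [eLpNorm']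
    have h3 := h2.trans (eLpNorm'_le_eLpNorm'_of_exponent_le zero_lt_one hq ν hcf)
    calc ‖c - m‖ₑ ^ q ≤ (eLpNorm' (fun y => c - f y) q ν) ^ q := by gcongr
      _ = _ := by
        rw [eLpNorm', ← ENNReal.rpow_mul, one_div, inv_mul_cancel₀ hq0.ne', ENNReal.rpow_one]
  calc ∫⁻ y, ‖f y - m‖ₑ ^ q ∂ν
      ≤ ∫⁻ y, 2 ^ (q - 1) * (‖c - f y‖ₑ ^ q + ‖c - m‖ₑ ^ q) ∂ν := by
        refine lintegral_mono fun y => ?_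
        refine le_trans ?_ (ENNReal.rpow_add_le_mul_rpow_add_rpow _ _ hq)
        gcongr
        have h : f y - m = (c - m) - (c - f y) := by ring
        rw [h, add_comm]
        exact enorm_sub_le
    _ = 2 ^ (q - 1) * (∫⁻ y, ‖c - f y‖ₑ ^ q ∂ν + ‖c - m‖ₑ ^ q) := by
        rw [lintegral_const_mul' _ _ (by finiteness), lintegral_add_right _ measurable_const]
        simp
    _ ≤ 2 ^ (q - 1) * (∫⁻ y, ‖c - f y‖ₑ ^ q ∂ν + ∫⁻ y, ‖c - f y‖ₑ ^ q ∂ν) := by gcongr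
    _ = 2 ^ q * ∫⁻ y, ‖c - f y‖ₑ ^ q ∂ν := by
        rw [← two_mul, ← mul_assoc]
        congr 1
        nth_rewrite 2 [← ENNReal.rpow_one 2]
        rw [← ENNReal.rpow_add _ _ two_ne_zero ofNat_ne_top]
        simp

/-- The same comparison for the mean value over a set of positive finite measure. -/
lemma setLIntegral_sub_average_rpow_le {α : Type*} [MeasurableSpace α] {μ : Measure α}
    {s : Set α} (hs0 : μ s ≠ 0) (hs : μ s ≠ ∞) {f : α → ℝ} (hf : IntegrableOn f s μ)
    {q : ℝ} (hq : 1 ≤ q) (c : ℝ) :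
    ∫⁻ y in s, ‖f y - ⨍ z in s, f z ∂μ‖ₑ ^ q ∂μ ≤ 2 ^ q * ∫⁻ y in s, ‖c - f y‖ₑ ^ q ∂μ := by
  have hprob : IsProbabilityMeasure ((μ s)⁻¹ • μ.restrict s) :=
    ⟨by simp [ENNReal.inv_mul_cancel hs0 hs]⟩
  have hint : Integrable f ((μ s)⁻¹ • μ.restrict s) :=
    Integrable.smul_measure hf (ENNReal.inv_ne_top.2 hs0)
  have h := lintegral_sub_integral_rpow_le _ hint hq c
  rw [lintegral_smul_measure, lintegral_smul_measure, smul_eq_mul, smul_eq_mul,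
    mul_left_comm] at h
  have hav : ⨍ z in s, f z ∂μ = ∫ z, f z ∂((μ s)⁻¹ • μ.restrict s) := by
    rw [average]; simp
  rw [hav]
  exact (ENNReal.mul_le_mul_iff_right (ENNReal.inv_ne_zero.2 hs) (ENNReal.inv_ne_top.2 hs0)).1 h

lemma lintegral_ofReal_add_norm_rpow (d : ℕ) (y : Fin d → ℝ) {h : ℝ} (hh : 0 < h) (a : ℝ) :
    ∫⁻ x : Fin d → ℝ, ENNReal.ofReal ((h + ‖x - y‖) ^ (-a)) =
      ENNReal.ofReal (h ^ (d - a)) *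
        ∫⁻ x : Fin d → ℝ, ENNReal.ofReal ((1 + ‖x‖) ^ (-a)) := by
  rw [lintegral_sub_right_eq_self (fun x : Fin d → ℝ => ENNReal.ofReal ((h + ‖x‖) ^ (-a))) y]
  have hmap := Measure.map_addHaar_smul (volume : Measure (Fin d → ℝ)) hh.ne'
  have hvol : (volume : Measure (Fin d → ℝ)) =
      ENNReal.ofReal (h ^ d) • Measure.map (h • ·) volume := by
    rw [hmap, smul_smul, ← ENNReal.ofReal_mul (by positivity), Module.finrank_fin_fun,
      abs_of_pos (by positivity), mul_inv_cancel₀ (by positivity)]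
    simp
  conv_lhs => rw [hvol]
  rw [lintegral_smul_measure, lintegral_map (by fun_prop) (by fun_prop), smul_eq_mul]
  have hpt : ∀ x : Fin d → ℝ, ENNReal.ofReal ((h + ‖h • x‖) ^ (-a)) =
      ENNReal.ofReal (h ^ (-a)) * ENNReal.ofReal ((1 + ‖x‖) ^ (-a)) := by
    intro x
    rw [norm_smul, Real.norm_of_nonneg hh.le, ← ENNReal.ofReal_mul (by positivity),
      ← Real.mul_rpow hh.le (by positivity)]
    ring_nf
  simp_rw [hpt]
  rw [lintegral_const_mul' _ _ ofReal_ne_top, ← mul_assoc, ← ENNReal.ofReal_mul (by positivity),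
    sub_eq_add_neg, Real.rpow_add hh, Real.rpow_natCast]

namespace Cube

variable {d : ℕ}

lemma measurableSet_toSet (Q : Cube d) : MeasurableSet Q.toSet :=
  measurableSet_closedBall

lemma volume_toSet (Q : Cube d) : volume Q.toSet = ENNReal.ofReal (Q.side ^ (d : ℝ)) := by
  rw [toSet, Real.volume_pi_closedBall _ (by linarith [Q.side_pos])]
  simp [mul_div_cancel₀]

lemma dist_le_side (Q : Cube d) {x y : Fin d → ℝ} (hx : x ∈ Q.toSet) (hy : y ∈ Q.toSet) :
    dist x y ≤ Q.side := by
  rw [toSet, Metric.mem_closedBall] at hx hy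
  linarith [dist_triangle_right x y Q.center]

lemma center_mem_toSet (Q : Cube d) : Q.center ∈ Q.toSet :=
  Metric.mem_closedBall_self (by linarith [Q.side_pos])

lemma interior_ae_eq_toSet (Q : Cube d) : interior Q.toSet =ᵐ[volume] Q.toSet :=
  interior_ae_eq_of_null_frontier ((convex_closedBall _ _).addHaar_frontier _)

lemma add_norm_sub_center_le_longDist (Q L : Cube d) {x : Fin d → ℝ} (hx : x ∈ Q.toSet) :
    L.side / 2 + ‖x - L.center‖ ≤ longDist Q L := by
  have h : ‖x - L.center‖ - Q.side - L.side / 2 ≤ setDist Q.toSet L.toSet := by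
    refine le_csInf ⟨_, Set.mem_image2_of_mem Q.center_mem_toSet L.center_mem_toSet⟩ ?_
    rintro _ ⟨u, hu, v, hv, rfl⟩
    have h1 := Q.dist_le_side hx hu
    rw [toSet, Metric.mem_closedBall] at hv
    rw [← dist_eq_norm]
    linarith [dist_triangle4 x u v L.center]
  rw [longDist]
  linarith

lemma longDist_pos (Q L : Cube d) : 0 < longDist Q L := by
  have := Q.add_norm_sub_center_le_longDist L Q.center_mem_toSet
  have := L.side_pos
  have := norm_nonneg (Q.center - L.center)
  linarith

end Cube

namespace WhitneyCovering

variable {d : ℕ} {Ω : Set (Fin d → ℝ)}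

lemma toSet_subset (W : WhitneyCovering d Ω) {Q : Cube d} (hQ : Q ∈ W.cubes) :
    Q.toSet ⊆ Ω := by
  conv_rhs => rw [← W.covers]
  exact Set.subset_biUnion_of_mem (u := Cube.toSet) hQ

lemma tsum_setLIntegral_le (W : WhitneyCovering d Ω) (g : (Fin d → ℝ) → ℝ≥0∞) :
    ∑' Q : {Q : Cube d // Q ∈ W.cubes}, ∫⁻ x in (Q : Cube d).toSet, g x ≤ ∫⁻ x in Ω, g x := by
  have hd : Pairwise (Function.onFun Disjoint
      fun Q : {Q : Cube d // Q ∈ W.cubes} => interior (Q : Cube d).toSet) := fun Q S hQS =>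
    Set.disjoint_iff_inter_eq_empty.2
      (W.essDisjoint Q Q.2 S S.2 (Subtype.coe_injective.ne hQS))
  have h := tsum_meas_le_meas_iUnion_of_disjoint (volume.withDensity g)
    (fun Q : {Q : Cube d // Q ∈ W.cubes} =>
      (isOpen_interior (s := (Q : Cube d).toSet)).measurableSet) hd
  rw [withDensity_apply _ (isOpen_iUnion fun _ => isOpen_interior).measurableSet] at h
  simp_rw [withDensity_apply _ (isOpen_interior).measurableSet,
    setLIntegral_congr (Cube.interior_ae_eq_toSet _)] at h
  exact h.trans (lintegral_mono_set
    (Set.iUnion_subset fun Q => interior_subset.trans (W.toSet_subset Q.2)))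

lemma tsum_longDist_rpow_mul_volume_le (W : WhitneyCovering d Ω) (L : Cube d) {a : ℝ}
    (ha : 0 ≤ a) :
    ∑' Q : {Q : Cube d // Q ∈ W.cubes},
        ENNReal.ofReal (longDist (Q : Cube d) L ^ (-a)) * volume (Q : Cube d).toSet ≤
      ENNReal.ofReal ((L.side / 2) ^ (d - a)) *
        ∫⁻ x : Fin d → ℝ, ENNReal.ofReal ((1 + ‖x‖) ^ (-a)) := by
  have hL : 0 < L.side / 2 := by linarith [L.side_pos]
  rw [← lintegral_ofReal_add_norm_rpow d L.center hL a]
  refine le_trans (ENNReal.tsum_le_tsum fun Q => ?_)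
    ((W.tsum_setLIntegral_le _).trans (setLIntegral_le_lintegral _ _))
  rw [← setLIntegral_const]
  refine setLIntegral_mono' (Q : Cube d).measurableSet_toSet fun x hx => ?_
  exact ENNReal.ofReal_le_ofReal (Real.rpow_le_rpow_of_nonpos (by positivity)
    ((Q : Cube d).add_norm_sub_center_le_longDist L hx) (by linarith))

end WhitneyCovering

/-- Mean oscillation over a cube is controlled by the local fractional seminorm. -/
lemma Cube.oscillation_rpow_mul_volume_le {d : ℕ} (L : Cube d) {f : (Fin d → ℝ) → ℝ}
    (hf : IntegrableOn f L.toSet) {p q b : ℝ} (hp : 0 < p) (hq : 1 ≤ q) (hb : 0 < b) :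
    (∫⁻ y in L.toSet, ‖f y - ⨍ z in L.toSet, f z‖ₑ ^ q) ^ (p / q) * volume L.toSet ≤
      2 ^ p * ENNReal.ofReal (L.side ^ (b * p / q)) *
        ∫⁻ x in L.toSet, (∫⁻ y in L.toSet, ‖f x - f y‖ₑ ^ q / edist x y ^ b) ^ (p / q) := by
  have hq0 : 0 < q := by linarith
  have hs := L.side_pos
  have hv0 : volume L.toSet ≠ 0 := by
    rw [L.volume_toSet]; exact (ENNReal.ofReal_pos.2 (by positivity)).ne'
  have hv : volume L.toSet ≠ ∞ := by rw [L.volume_toSet]; exact ofReal_ne_top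
  rw [← setLIntegral_const, ← lintegral_const_mul' _ _ (by finiteness)]
  refine setLIntegral_mono' L.measurableSet_toSet fun x hx => ?_
  have hker : ∫⁻ y in L.toSet, ‖f x - f y‖ₑ ^ q ≤ ENNReal.ofReal (L.side ^ b) *
      ∫⁻ y in L.toSet, ‖f x - f y‖ₑ ^ q / edist x y ^ b := by
    rw [← lintegral_const_mul' _ _ ofReal_ne_top]
    refine setLIntegral_mono' L.measurableSet_toSet fun y hy => ?_
    rcases eq_or_ne x y with rfl | hxy
    · simp [hq0]
    have hd0 : edist x y ^ b ≠ 0 := by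
      simp [ENNReal.rpow_eq_zero_iff, hxy, edist_ne_top]
    have hd : edist x y ^ b ≠ ∞ := ENNReal.rpow_ne_top_of_nonneg hb.le (edist_ne_top _ _)
    calc ‖f x - f y‖ₑ ^ q = edist x y ^ b * (‖f x - f y‖ₑ ^ q / edist x y ^ b) :=
          (ENNReal.mul_div_cancel hd0 hd).symm
      _ ≤ _ := by
          gcongr
          rw [← ENNReal.ofReal_rpow_of_pos hs]
          gcongr
          rw [edist_dist]
          exact ENNReal.ofReal_le_ofReal (L.dist_le_side hx hy)
  calc (∫⁻ y in L.toSet, ‖f y - ⨍ z in L.toSet, f z‖ₑ ^ q) ^ (p / q)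
      ≤ (2 ^ q * (ENNReal.ofReal (L.side ^ b) *
          ∫⁻ y in L.toSet, ‖f x - f y‖ₑ ^ q / edist x y ^ b)) ^ (p / q) := by
        gcongr
        exact (setLIntegral_sub_average_rpow_le hv0 hv hf hq (f x)).trans (by gcongr)
    _ = _ := by
        rw [ENNReal.mul_rpow_of_nonneg _ _ (by positivity),
          ENNReal.mul_rpow_of_nonneg _ _ (by positivity), ← ENNReal.rpow_mul,
          mul_div_cancel₀ _ hq0.ne', ENNReal.ofReal_rpow_of_pos (by positivity),
          ← Real.rpow_mul hs.le, mul_assoc, mul_div_assoc]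

/-- case `p < q` of the control of nonlocal sums: for a uniform domain `Ω`
with Whitney covering `W`, `0 < σ < 1`, `1 ≤ p < q < ∞` with `σ > d/p − d/q`, and
`f ∈ L¹_loc(Ω)`,
`Σ_{Q∈W} (Σ_{L∈W} ∫_L |f−f_L|^q / D(Q,L)^{σq+d})^{p/q} ℓ(Q)^d ≤ C ‖f‖^p_{Ȧ^σ_{p,q}(Ω)}`. -/
theorem stmt_13 (d : ℕ) (hd : 1 ≤ d) (σ p q ε : ℝ) (hσ0 : 0 < σ) (hσ1 : σ < 1)
    (hp : 1 ≤ p) (hpq : p < q) (hσpq : σ > d / p - d / q) (hε : 0 < ε) :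
    ∃ C : ℝ≥0∞, C ≠ ⊤ ∧
      ∀ (Ω : Set (Fin d → ℝ)), IsOpen Ω → IsConnected Ω → Ω ≠ Set.univ →
      ∀ (W : WhitneyCovering d Ω), IsUniformDomain W ε →
      ∀ f : (Fin d → ℝ) → ℝ, MeasureTheory.LocallyIntegrableOn f Ω volume →
      (∑' Q : {Q : Cube d // Q ∈ W.cubes},
          (∑' L : {L : Cube d // L ∈ W.cubes},
              ∫⁻ y in (L : Cube d).toSet,
                (‖f y - ⨍ z in (L : Cube d).toSet, f z‖₊ : ℝ≥0∞) ^ q /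
                  ENNReal.ofReal (longDist (Q : Cube d) (L : Cube d) ^ (σ * q + d))) ^ (p / q) *
            ENNReal.ofReal ((Q : Cube d).side ^ (d : ℝ))) ≤
        C * ∫⁻ x in Ω, (∫⁻ y in Ω,
            (‖f x - f y‖₊ : ℝ≥0∞) ^ q / edist x y ^ (σ * q + d)) ^ (p / q) := by
  have hq0 : 0 < q := by linarith
  have hp0 : 0 < p := by linarith
  have hb : 0 < σ * q + d := by positivity
  set b := σ * q + d with hb_def
  set a := b * p / q with ha_def
  have ha : (d : ℝ) < a := by
    have h1 : a = σ * p + d * p / q := by rw [ha_def, hb_def]; field_simp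
    have h2 : (d / p - d / q) * p < σ * p := by gcongr
    have h3 : ((d : ℝ) / p - d / q) * p = d - d * p / q := by field_simp
    linarith
  have ha0 : 0 ≤ a := by positivity
  set I := ∫⁻ x : Fin d → ℝ, ENNReal.ofReal ((1 + ‖x‖) ^ (-a))
  have hI : I ≠ ⊤ := (finite_integral_one_add_norm (by simpa using ha)).ne
  refine ⟨ENNReal.ofReal (2 ^ (a - d)) * I * 2 ^ p, by finiteness, ?_⟩
  intro Ω _ _ _ W _ f hf
  set A : Cube d → ℝ≥0∞ := fun L =>
    (∫⁻ y in L.toSet, ‖f y - ⨍ z in L.toSet, f z‖ₑ ^ q) ^ (p / q)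
  set F : (Fin d → ℝ) → ℝ≥0∞ := fun x =>
    (∫⁻ y in Ω, ‖f x - f y‖ₑ ^ q / edist x y ^ b) ^ (p / q)
  have hterm : ∀ Q L : Cube d,
      (∫⁻ y in L.toSet, ‖f y - ⨍ z in L.toSet, f z‖ₑ ^ q /
        ENNReal.ofReal (longDist Q L ^ b)) ^ (p / q) =
      A L * ENNReal.ofReal (longDist Q L ^ (-a)) := by
    intro Q L
    have hD := Q.longDist_pos L
    simp_rw [div_eq_mul_inv (_ ^ q)]
    rw [← ENNReal.ofReal_inv_of_pos (by positivity), lintegral_mul_const' _ _ ofReal_ne_top,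
      ENNReal.mul_rpow_of_nonneg _ _ (by positivity), ENNReal.ofReal_rpow_of_pos (by positivity),
      ← Real.rpow_neg hD.le, ← Real.rpow_mul hD.le, neg_mul, ← mul_div_assoc]
  have hcube : ∀ L ∈ W.cubes, A L * (ENNReal.ofReal ((L.side / 2) ^ (d - a)) * I) ≤
      ENNReal.ofReal (2 ^ (a - d)) * I * 2 ^ p * ∫⁻ x in L.toSet, F x := by
    intro L hL
    have hs := L.side_pos
    have hint : IntegrableOn f L.toSet :=
      hf.integrableOn_compact_subset (W.toSet_subset hL) (isCompact_closedBall _ _)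
    have h := L.oscillation_rpow_mul_volume_le hint hp0 (hp.trans hpq.le) hb
    rw [L.volume_toSet] at h
    have hsplit : ENNReal.ofReal ((L.side / 2) ^ (d - a)) =
        ENNReal.ofReal (L.side ^ (d : ℝ)) * ENNReal.ofReal (L.side ^ (-a)) *
          ENNReal.ofReal (2 ^ (a - d)) := by
      rw [← ENNReal.ofReal_mul (by positivity), ← ENNReal.ofReal_mul (by positivity),
        ← Real.rpow_add hs, Real.div_rpow hs.le zero_le_two, div_eq_mul_inv,
        ← Real.rpow_neg zero_le_two]
      ring_nf
    have hcancel : ENNReal.ofReal (L.side ^ a) * ENNReal.ofReal (L.side ^ (-a)) = 1 := by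
      rw [← ENNReal.ofReal_mul (by positivity), ← Real.rpow_add hs]
      simp
    calc A L * (ENNReal.ofReal ((L.side / 2) ^ (d - a)) * I)
        = A L * ENNReal.ofReal (L.side ^ (d : ℝ)) *
            (ENNReal.ofReal (L.side ^ (-a)) * ENNReal.ofReal (2 ^ (a - d)) * I) := by
          rw [hsplit]; ring
      _ ≤ 2 ^ p * ENNReal.ofReal (L.side ^ a) * (∫⁻ x in L.toSet, F x) *
            (ENNReal.ofReal (L.side ^ (-a)) * ENNReal.ofReal (2 ^ (a - d)) * I) := by
          refine mul_le_mul_left (h.trans ?_) _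
          gcongr
          exact ENNReal.rpow_le_rpow (lintegral_mono_set (W.toSet_subset hL)) (by positivity)
      _ = (ENNReal.ofReal (L.side ^ a) * ENNReal.ofReal (L.side ^ (-a))) *
            (ENNReal.ofReal (2 ^ (a - d)) * I * 2 ^ p * ∫⁻ x in L.toSet, F x) := by ring
      _ = _ := by rw [hcancel, one_mul]
  calc _ ≤ ∑' Q : {Q : Cube d // Q ∈ W.cubes}, ∑' L : {L : Cube d // L ∈ W.cubes},
          A L * (ENNReal.ofReal (longDist (Q : Cube d) L ^ (-a)) *
            volume (Q : Cube d).toSet) := by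
        refine ENNReal.tsum_le_tsum fun Q => ?_
        refine (mul_le_mul_left (tsum_rpow_le_tsum_rpow _ (div_pos hp0 hq0)
          ((div_le_one hq0).2 hpq.le)) _).trans_eq ?_
        rw [← ENNReal.tsum_mul_right]
        refine tsum_congr fun L => ?_
        rw [Cube.volume_toSet, ← mul_assoc]
        exact congrArg (· * _) (hterm Q L)
    _ = ∑' L : {L : Cube d // L ∈ W.cubes}, A L * ∑' Q : {Q : Cube d // Q ∈ W.cubes},
          ENNReal.ofReal (longDist (Q : Cube d) L ^ (-a)) * volume (Q : Cube d).toSet := by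
        rw [ENNReal.tsum_comm]
        simp_rw [ENNReal.tsum_mul_left]
    _ ≤ ∑' L : {L : Cube d // L ∈ W.cubes},
          ENNReal.ofReal (2 ^ (a - d)) * I * 2 ^ p * ∫⁻ x in (L : Cube d).toSet, F x := by
        refine ENNReal.tsum_le_tsum fun L => ?_
        exact (mul_le_mul_right (W.tsum_longDist_rpow_mul_volume_le L ha0) _).trans
          (hcube L L.2)
    _ ≤ ENNReal.ofReal (2 ^ (a - d)) * I * 2 ^ p * ∫⁻ x in Ω, F x := by
        rw [ENNReal.tsum_mul_left]
        gcongr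
        exact W.tsum_setLIntegral_le F
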